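/- arXiv:2107.09336 — 5 statements merged into one kernel-verified Lean document; each statement's English description precedes it below -/
import Mathlib

section
/- Let m ≥ 2 be an integer, p ∈ (1,∞), and fix j ∈ {1,…,m}. There exist constants c > 0 and δ > 0 such that for every z = (z_1,…,z_m) with z_i ≥ 0 for all i, ∑_{i=1}^m z_i^p = 1, and ‖z − e_j‖ ≤ δ (Euclidean norm), one has Ψ(z) ≥ c ‖z − e_j‖. -/
open scoped BigOperators

theorem EuclideanSpace.norm_le_sum_abs {ι : Type*} [Fintype ι] (x : EuclideanSpace ℝ ι) :
    ‖x‖ ≤ ∑ i, |x i| := by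
  classical
  calc ‖x‖ = ‖∑ i, EuclideanSpace.single i (x i)‖ := by
        congr 1
        ext k
        simp [WithLp.ofLp_sum, Finset.sum_apply, Pi.single_apply]
    _ ≤ ∑ i, ‖EuclideanSpace.single i (x i)‖ := norm_sum_le _ _
    _ = ∑ i, |x i| := by simp

/-- Let `m ≥ 2`, `p ∈ (1,∞)`, and fix `j`. There exist `c > 0` and `δ > 0`
such that for every `z` with nonnegative coordinates, `∑ z_i^p = 1`, and `‖z − e_j‖ ≤ δ`
(Euclidean norm), one has `Ψ(z) ≥ c ‖z − e_j‖`. -/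
theorem psi_lower_bound_near_basis (m : ℕ) (hm : 2 ≤ m) (p : ℝ) (hp : 1 < p) (j : Fin m) :
    ∃ c > (0 : ℝ), ∃ δ > (0 : ℝ), ∀ z : EuclideanSpace ℝ (Fin m),
      (∀ i, 0 ≤ z i) → (∑ i, (z i) ^ p) = 1 →
      ‖z - EuclideanSpace.single j (1 : ℝ)‖ ≤ δ →
      c * ‖z - EuclideanSpace.single j (1 : ℝ)‖ ≤ (∑ i, z i) ^ p - ∑ i, (z i) ^ p := by
  have hp1 : 0 < p - 1 := sub_pos.2 hp
  refine ⟨1 / 3, by norm_num, (1 / 2 : ℝ) ^ (p - 1)⁻¹, by positivity, fun z hz hsum hδ => ?_⟩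
  set s := ∑ i ∈ Finset.univ.erase j, z i with hs
  have hs0 : 0 ≤ s := Finset.sum_nonneg fun i _ => hz i
  have hS : ∑ i, z i = z j + s := (Finset.add_sum_erase _ _ (Finset.mem_univ j)).symm
  have hpow : z j ^ p + ∑ i ∈ Finset.univ.erase j, z i ^ p = 1 :=
    (Finset.add_sum_erase _ (fun i => z i ^ p) (Finset.mem_univ j)).trans hsum
  have hpow0 : 0 ≤ ∑ i ∈ Finset.univ.erase j, z i ^ p :=
    Finset.sum_nonneg fun i _ => Real.rpow_nonneg (hz i) p
  have hj1 : z j ≤ 1 := by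
    by_contra! h
    linarith [Real.one_lt_rpow h (zero_lt_one.trans hp)]
  have hjp : z j ^ p ≤ z j := Real.rpow_le_self_of_le_one (hz j) hj1 hp.le
  have hsmall : ∑ i ∈ Finset.univ.erase j, z i ^ p ≤ 1 / 2 * s := by
    rw [hs, Finset.mul_sum]
    refine Finset.sum_le_sum fun i hi => ?_
    have hle : z i ≤ (1 / 2 : ℝ) ^ (p - 1)⁻¹ := by
      have h := PiLp.norm_apply_le (z - EuclideanSpace.single j (1 : ℝ)) i
      simp only [PiLp.sub_apply, PiLp.single_apply, if_neg (Finset.ne_of_mem_erase hi), sub_zero,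
        Real.norm_eq_abs] at h
      exact (le_abs_self _).trans (h.trans hδ)
    have hhalf : z i ^ (p - 1) ≤ 1 / 2 := by
      calc z i ^ (p - 1) ≤ ((1 / 2 : ℝ) ^ (p - 1)⁻¹) ^ (p - 1) :=
            Real.rpow_le_rpow (hz i) hle hp1.le
        _ = 1 / 2 := Real.rpow_inv_rpow (by norm_num) hp1.ne'
    calc z i ^ p = z i ^ (p - 1) * z i := by
          rw [← Real.rpow_add_one' (hz i) (by linarith), sub_add_cancel]
      _ ≤ 1 / 2 * z i := mul_le_mul_of_nonneg_right hhalf (hz i)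
  have hnorm : ‖z - EuclideanSpace.single j (1 : ℝ)‖ ≤ (1 - z j) + s := by
    refine (EuclideanSpace.norm_le_sum_abs _).trans_eq ?_
    rw [← Finset.add_sum_erase _ _ (Finset.mem_univ j)]
    congr 1
    · simp [abs_sub_comm (z j), abs_of_nonneg (sub_nonneg.2 hj1)]
    · refine Finset.sum_congr rfl fun i hi => ?_
      simp [Finset.ne_of_mem_erase hi, abs_of_nonneg (hz i)]
  have hbern : 1 + p * (z j + s - 1) ≤ (z j + s) ^ p := by
    simpa using one_add_mul_self_le_rpow_one_add (by linarith [hz j] : -1 ≤ z j + s - 1) hp.le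
  have hgap : z j + s - 1 ≤ p * (z j + s - 1) := le_mul_of_one_le_left (by linarith) hp.le
  rw [hsum, hS]
  linarith
end

section
/- Let m ≥ 2 be an integer and p ∈ (1,∞). There exists δ > 0 such that for every z = (z_1,…,z_m) with z_j ≥ 0 for all j, ∑_{j=1}^m z_j^p = 1, and |z_1 − 1| + ∑_{j=2}^m z_j ≤ δ, one has (∑_{j=1}^m z_j)^p ≥ 1 + (p/4)(|z_1 − 1| + ∑_{j=2}^m z_j). -/
open scoped BigOperators

/-- Let `m ≥ 2` and `p ∈ (1,∞)`. There exists `δ > 0` such that for every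
`z` with nonnegative coordinates, `∑ z_j^p = 1`, and ℓ₁-distance from `z` to `e_1` at most
`δ`, one has `(∑ z_j)^p ≥ 1 + (p/4)(|z_1 − 1| + ∑_{j≥2} z_j)`. (Here the first coordinate
is indexed by `0 : Fin m`.) -/
theorem sum_pow_lower_bound (m : ℕ) (hm : 2 ≤ m) (p : ℝ) (hp : 1 < p) :
    ∃ δ > (0 : ℝ), ∀ z : Fin m → ℝ,
      (∀ j, 0 ≤ z j) → (∑ j, (z j) ^ p) = 1 →
      |z ⟨0, by omega⟩ - 1| + ∑ j ∈ Finset.univ.erase ⟨0, by omega⟩, z j ≤ δ →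
      1 + (p / 4) * (|z ⟨0, by omega⟩ - 1| + ∑ j ∈ Finset.univ.erase ⟨0, by omega⟩, z j)
        ≤ (∑ j, z j) ^ p := by
  have hp' : 0 < p - 1 := by linarith
  refine ⟨(1 / 2 : ℝ) ^ (p - 1)⁻¹, by positivity, fun z hz hsum hδ => ?_⟩
  set i : Fin m := ⟨0, by omega⟩
  set T := ∑ j ∈ Finset.univ.erase i, z j with hT
  have hsplit : z i + T = ∑ j, z j := Finset.add_sum_erase _ _ (Finset.mem_univ i)
  have hsplitp : z i ^ p + ∑ j ∈ Finset.univ.erase i, z j ^ p = 1 :=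
    (Finset.add_sum_erase _ (fun j => z j ^ p) (Finset.mem_univ i)).trans hsum
  have hrest : 0 ≤ ∑ j ∈ Finset.univ.erase i, z j ^ p :=
    Finset.sum_nonneg fun j _ => Real.rpow_nonneg (hz j) p
  have hzi : z i ≤ 1 := by
    by_contra! h
    linarith [Real.one_lt_rpow h (by linarith : 0 < p)]
  have hpow : z i ^ p ≤ z i := by
    rcases (hz i).eq_or_lt with h | h
    · rw [← h, Real.zero_rpow (by linarith)]
    · simpa using Real.rpow_le_rpow_of_exponent_ge h hzi hp.le
  have hterm : ∀ j ∈ Finset.univ.erase i, z j ^ p ≤ 1 / 2 * z j := by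
    intro j hj
    have hjT : z j ≤ T := Finset.single_le_sum (fun k _ => hz k) hj
    have hjδ : z j ≤ (1 / 2 : ℝ) ^ (p - 1)⁻¹ := by linarith [abs_nonneg (z i - 1)]
    have hhalf : z j ^ (p - 1) ≤ 1 / 2 := by
      refine (Real.rpow_le_rpow (hz j) hjδ hp'.le).trans_eq ?_
      rw [← Real.rpow_mul (by norm_num), inv_mul_cancel₀ hp'.ne', Real.rpow_one]
    calc z j ^ p = z j ^ (p - 1) * z j := by
          rw [← Real.rpow_add_one' (hz j) (by linarith), sub_add_cancel]
      _ ≤ 1 / 2 * z j := mul_le_mul_of_nonneg_right hhalf (hz j)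
  have hhalfT : ∑ j ∈ Finset.univ.erase i, z j ^ p ≤ 1 / 2 * T := by
    rw [hT, Finset.mul_sum]
    exact Finset.sum_le_sum hterm
  rw [abs_of_nonpos (by linarith), ← hsplit]
  have hbern := one_add_mul_self_le_rpow_one_add (s := z i + T - 1) (by linarith [hz i]) hp.le
  rw [add_sub_cancel] at hbern
  refine le_trans ?_ hbern
  nlinarith
end

section
/- Let p ∈ (1,2] and let ℓ ≥ 1 be an integer. The function M_p(y,z) = min(|y|^{p−1} z, |y| z^{p−1}) is locally Lipschitz on ℝ^ℓ × [0,∞): for every bounded set K ⊆ ℝ^ℓ × [0,∞) there exists L > 0 such that M_p is Lipschitz with constant L on K. -/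
open scoped BigOperators

/-- For `0 ≤ s ≤ t` and `a ≤ 1`, `t ^ a * s ≤ s ^ a * t`. -/
lemma rpow_mul_le_rpow_mul_of_le {a s t : ℝ} (ha1 : a ≤ 1) (hs : 0 ≤ s) (hst : s ≤ t) :
    t ^ a * s ≤ s ^ a * t := by
  have split : ∀ x : ℝ, 0 ≤ x → x = x ^ a * x ^ (1 - a) := fun x hx => by
    rw [← Real.rpow_add' hx (by norm_num), add_sub_cancel, Real.rpow_one]
  have ht := hs.trans hst
  have hpow : s ^ (1 - a) ≤ t ^ (1 - a) := Real.rpow_le_rpow hs hst (by linarith)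
  calc t ^ a * s = t ^ a * s ^ a * s ^ (1 - a) := by
        rw [mul_assoc, ← split s hs]
    _ ≤ t ^ a * s ^ a * t ^ (1 - a) := by gcongr
    _ = s ^ a * t := by
        rw [mul_comm (t ^ a), mul_assoc, ← split t ht]

lemma min_rpow_mul_eq_max_rpow_mul_min {a u z : ℝ} (ha1 : a ≤ 1) (hu : 0 ≤ u) (hz : 0 ≤ z) :
    min (u ^ a * z) (u * z ^ a) = max u z ^ a * min u z := by
  rcases le_total u z with h | h
  · rw [max_eq_right h, min_eq_left h, mul_comm u, min_eq_right]
    exact rpow_mul_le_rpow_mul_of_le ha1 hu h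
  · rw [max_eq_left h, min_eq_right h, mul_comm u, min_eq_left]
    exact rpow_mul_le_rpow_mul_of_le ha1 hz h

lemma abs_rpow_mul_sub_rpow_mul_le {a R M m N n : ℝ} (ha0 : 0 ≤ a) (ha1 : a ≤ 1)
    (hm : 0 ≤ m) (hmM : m ≤ M) (hn : 0 ≤ n) (hnN : n ≤ N) (hM : M ≤ R) (hN : N ≤ R) :
    |M ^ a * m - N ^ a * n| ≤ R ^ a * (|m - n| + |M - N|) := by
  wlog h : N ≤ M generalizing M m N n
  · rw [abs_sub_comm, abs_sub_comm m, abs_sub_comm M]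
    exact this hn hnN hm hmM hN hM (le_of_not_ge h)
  have hN0 := hn.trans hnN
  have hM0 := hm.trans hmM
  have hMN : N ^ a ≤ M ^ a := Real.rpow_le_rpow hN0 h ha0
  have hMR : M ^ a ≤ R ^ a := Real.rpow_le_rpow hM0 hM ha0
  have hNR : N ^ a ≤ R ^ a := hMN.trans hMR
  have hdiff : (M ^ a - N ^ a) * n ≤ R ^ a * |M - N| := by
    calc (M ^ a - N ^ a) * n ≤ (M ^ a - N ^ a) * N :=
          mul_le_mul_of_nonneg_left hnN (sub_nonneg.2 hMN)
      _ ≤ N ^ a * (M - N) := by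
          linarith [rpow_mul_le_rpow_mul_of_le ha1 hN0 h]
      _ ≤ R ^ a * |M - N| :=
          mul_le_mul hNR (le_abs_self _) (sub_nonneg.2 h) ((Real.rpow_nonneg hN0 a).trans hNR)
  calc |M ^ a * m - N ^ a * n| = |M ^ a * (m - n) + (M ^ a - N ^ a) * n| := by ring_nf
    _ ≤ |M ^ a * (m - n)| + |(M ^ a - N ^ a) * n| := abs_add_le _ _
    _ = M ^ a * |m - n| + (M ^ a - N ^ a) * n := by
        rw [abs_mul, abs_of_nonneg (Real.rpow_nonneg hM0 a),
          abs_of_nonneg (mul_nonneg (sub_nonneg.2 hMN) hn)]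
    _ ≤ R ^ a * |m - n| + R ^ a * |M - N| := by gcongr
    _ = R ^ a * (|m - n| + |M - N|) := by ring


/-- Let `p ∈ (1,2]` and `ℓ ≥ 1`. The function
`M_p(y,z) = min(|y|^{p−1} z, |y| z^{p−1})` is locally Lipschitz on `ℝ^ℓ × [0,∞)`:
for every bounded set `K ⊆ ℝ^ℓ × [0,∞)` there exists `L > 0` such that `M_p` is
Lipschitz with constant `L` on `K`. -/
theorem Mp_locally_lipschitz (l : ℕ) (hl : 1 ≤ l) (p : ℝ) (hp1 : 1 < p) (hp2 : p ≤ 2)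
    (K : Set (EuclideanSpace ℝ (Fin l) × ℝ))
    (hK : Bornology.IsBounded K) (hK0 : ∀ q ∈ K, 0 ≤ q.2) :
    ∃ L : NNReal, 0 < L ∧
      LipschitzOnWith L
        (fun q : EuclideanSpace ℝ (Fin l) × ℝ =>
          min (‖q.1‖ ^ (p - 1) * q.2) (‖q.1‖ * q.2 ^ (p - 1))) K := by
  obtain ⟨R, hR0, hR⟩ := hK.exists_pos_norm_le
  have hbound : ∀ q ∈ K, max ‖q.1‖ q.2 ≤ R := fun q hq =>
    max_le ((norm_fst_le q).trans (hR q hq))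
      ((le_abs_self q.2).trans ((norm_snd_le q).trans (hR q hq)))
  have hL : 0 < R ^ (p - 1) * 2 := by positivity
  refine ⟨NNReal.mk (R ^ (p - 1) * 2) hL.le, hL, LipschitzOnWith.of_dist_le_mul fun x hx y hy => ?_⟩
  have hx2 := hK0 x hx
  have hy2 := hK0 y hy
  have hd : max |‖x.1‖ - ‖y.1‖| |x.2 - y.2| ≤ dist x y := by
    rw [Prod.dist_eq]
    exact max_le_max ((abs_norm_sub_norm_le _ _).trans_eq (dist_eq_norm _ _).symm)
      (Real.dist_eq _ _).ge
  have hmin := (abs_min_sub_min_le_max ‖x.1‖ x.2 ‖y.1‖ y.2).trans hd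
  have hmax := (abs_max_sub_max_le_max ‖x.1‖ x.2 ‖y.1‖ y.2).trans hd
  have hp : p - 1 ≤ 1 := by linarith
  rw [Real.dist_eq, min_rpow_mul_eq_max_rpow_mul_min hp (norm_nonneg _) hx2,
    min_rpow_mul_eq_max_rpow_mul_min hp (norm_nonneg _) hy2]
  refine (abs_rpow_mul_sub_rpow_mul_le (by linarith) hp (le_min (norm_nonneg _) hx2) min_le_max
    (le_min (norm_nonneg _) hy2) min_le_max (hbound x hx) (hbound y hy)).trans ?_
  rw [NNReal.coe_mk, mul_assoc]
  gcongr
  linarith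
end

section
/- Let p ∈ (1,2]. There exists a constant C > 0 such that for all a, b ∈ ℝ one has |θ(a+b) − θ(a)| ≤ C θ(b). -/
theorem Real.add_rpow_le_add_rpow_of_one_le {q x y : ℝ} (hq : q ≤ 1) (hx : 0 ≤ x) (hy : 1 ≤ y) :
    (x + y) ^ q ≤ x + y ^ q := by
  have hy0 : 0 < y := by linarith
  have hxy : 0 < x + y := by linarith
  have h1 : (x + y) ^ (q - 1) ≤ 1 :=
    Real.rpow_le_one_of_one_le_of_nonpos (by linarith) (by linarith)
  have h2 : (x + y) ^ (q - 1) ≤ y ^ (q - 1) :=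
    Real.rpow_le_rpow_of_nonpos hy0 (by linarith) (by linarith)
  have e (z : ℝ) (hz : 0 < z) : z ^ q = z * z ^ (q - 1) := by
    rw [Real.rpow_sub_one hz.ne']
    field_simp
  rw [e _ hxy, e _ hy0]
  nlinarith [mul_le_mul_of_nonneg_left h1 hx, mul_le_mul_of_nonneg_left h2 hy0.le]

theorem min_self_rpow_add_le {q x y : ℝ} (hq0 : 0 < q) (hq : q ≤ 1) (hx : 0 ≤ x) (hy : 0 ≤ y) :
    min (x + y) ((x + y) ^ q) ≤ min x (x ^ q) + min y (y ^ q) := by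
  have small (z : ℝ) (hz : 0 ≤ z) (hz1 : z ≤ 1) : min z (z ^ q) = z :=
    min_eq_left (Real.self_le_rpow_of_le_one hz hz1 hq)
  have large (z : ℝ) (hz1 : 1 ≤ z) : min z (z ^ q) = z ^ q :=
    min_eq_right (Real.rpow_le_self_of_one_le hz1 hq)
  rcases le_total x 1 with hx1 | hx1 <;> rcases le_total y 1 with hy1 | hy1
  · rw [small x hx hx1, small y hy hy1]
    exact min_le_left _ _
  · rw [small x hx hx1, large y hy1]
    exact (min_le_right _ _).trans (Real.add_rpow_le_add_rpow_of_one_le hq hx hy1)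
  · rw [large x hx1, small y hy hy1, add_comm x y, add_comm (x ^ q)]
    exact (min_le_right _ _).trans (Real.add_rpow_le_add_rpow_of_one_le hq hy hx1)
  · rw [large x hx1, large y hy1]
    exact (min_le_right _ _).trans (Real.rpow_add_le_add_rpow hx hy hq0.le hq)

theorem min_abs_rpow_add_le {q : ℝ} (hq0 : 0 < q) (hq : q ≤ 1) (a b : ℝ) :
    min |a + b| (|a + b| ^ q) ≤ min |a| (|a| ^ q) + min |b| (|b| ^ q) := by
  have h := abs_add_le a b
  exact (min_le_min h (Real.rpow_le_rpow (abs_nonneg _) h hq0.le)).trans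
    (min_self_rpow_add_le hq0 hq (abs_nonneg a) (abs_nonneg b))

/-- Let `p ∈ (1,2]` and `θ(t) = min(|t|, |t|^{p−1})`. There exists a
constant `C > 0` such that for all `a, b ∈ ℝ` one has `|θ(a+b) − θ(a)| ≤ C θ(b)`. -/
theorem theta_difference_bound (p : ℝ) (hp1 : 1 < p) (hp2 : p ≤ 2) :
    ∃ C > (0 : ℝ), ∀ a b : ℝ,
      |min |a + b| (|a + b| ^ (p - 1)) - min |a| (|a| ^ (p - 1))|
        ≤ C * min |b| (|b| ^ (p - 1)) := by
  have hq0 : 0 < p - 1 := by linarith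
  have hq : p - 1 ≤ 1 := by linarith
  refine ⟨1, one_pos, fun a b => ?_⟩
  have h1 := min_abs_rpow_add_le hq0 hq a b
  have h2 := min_abs_rpow_add_le hq0 hq (a + b) (-b)
  rw [add_neg_cancel_right, abs_neg] at h2
  rw [one_mul, abs_le]
  constructor <;> linarith
end

section
/- For all reals x_1, x_2, x_3, z_1, z_2, z_3 with |x_1| ≤ z_1, |x_2| ≤ z_2, |x_3| ≤ z_3, one has |(x_3 − x_2)|x_3 − x_2| + (x_1 − x_3)|x_1 − x_3| + (x_2 − x_1)|x_2 − x_1|| ≤ 2(z_1 z_2 + z_1 z_3 + z_2 z_3). -/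
/-- For all reals `x_1, x_2, x_3, z_1, z_2, z_3` with `|x_i| ≤ z_i`,
one has `|(x_3 − x_2)|x_3 − x_2| + (x_1 − x_3)|x_1 − x_3| + (x_2 − x_1)|x_2 − x_1||
≤ 2(z_1 z_2 + z_1 z_3 + z_2 z_3)`. -/
theorem slavin_inequality (x₁ x₂ x₃ z₁ z₂ z₃ : ℝ)
    (h₁ : |x₁| ≤ z₁) (h₂ : |x₂| ≤ z₂) (h₃ : |x₃| ≤ z₃) :
    abs ((x₃ - x₂) * |x₃ - x₂| + (x₁ - x₃) * |x₁ - x₃| + (x₂ - x₁) * |x₂ - x₁|)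
      ≤ 2 * (z₁ * z₂ + z₁ * z₃ + z₂ * z₃) := by
  have abs_mul_bound : ∀ {a b u v : ℝ}, |a| ≤ u → |b| ≤ v →
      -(u * v) ≤ a * b ∧ a * b ≤ u * v := by
    intro a b u v ha hb
    rw [← abs_le, abs_mul]
    exact mul_le_mul ha hb (abs_nonneg b) ((abs_nonneg a).trans ha)
  obtain ⟨l₁₂, u₁₂⟩ := abs_mul_bound h₁ h₂
  obtain ⟨l₁₃, u₁₃⟩ := abs_mul_bound h₁ h₃
  obtain ⟨l₂₃, u₂₃⟩ := abs_mul_bound h₂ h₃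
  rw [abs_le]
  rcases abs_cases (x₃ - x₂) with ⟨e₁, s₁⟩ | ⟨e₁, s₁⟩ <;>
  rcases abs_cases (x₁ - x₃) with ⟨e₂, s₂⟩ | ⟨e₂, s₂⟩ <;>
  rcases abs_cases (x₂ - x₁) with ⟨e₃, s₃⟩ | ⟨e₃, s₃⟩ <;>
  rw [e₁, e₂, e₃] <;> constructor <;>
  nlinarith [sq_nonneg x₁, sq_nonneg x₂, sq_nonneg x₃]
end
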